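/- For every positive integer n ≥ 2, inv(n) ≤ inv(n−1) + 1, where inv(n) denotes the maximum inversion number over all tournaments of order n. -/

import Mathlib

/-- An oriented graph: a digraph with no loops and no pair of opposite arcs. -/
structure OrientedGraph (V : Type*) where
  arc : V → V → Prop
  irrefl' : ∀ v, ¬ arc v v
  asymm' : ∀ u v, arc u v → ¬ arc v u

namespace OrientedGraph

variable {V : Type*}

/-- An oriented graph is acyclic if it has no directed cycle. -/
def IsAcyclic (D : OrientedGraph V) : Prop := ∀ v, ¬ Relation.TransGen D.arc v v

/-- The result of inverting the sets `X 0, …, X (k-1)` one after another: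
an arc is reversed iff an odd number of the sets contain both of its end-vertices. -/
def invert (D : OrientedGraph V) {k : ℕ} (X : Fin k → Set V) : OrientedGraph V where
  arc u v := (Even {i : Fin k | u ∈ X i ∧ v ∈ X i}.ncard ∧ D.arc u v) ∨
    (¬ Even {i : Fin k | u ∈ X i ∧ v ∈ X i}.ncard ∧ D.arc v u)
  irrefl' v h := by
    rcases h with ⟨_, h⟩ | ⟨_, h⟩ <;> exact D.irrefl' v h
  asymm' u v h1 h2 := by
    have hs : {i : Fin k | v ∈ X i ∧ u ∈ X i} = {i : Fin k | u ∈ X i ∧ v ∈ X i} := by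
      ext i; simp only [Set.mem_setOf_eq]; exact and_comm
    rcases h1 with ⟨hE, h1⟩ | ⟨hE, h1⟩ <;> rcases h2 with ⟨hE', h2⟩ | ⟨hE', h2⟩ <;>
      rw [hs] at hE'
    · exact D.asymm' u v h1 h2
    · exact hE' hE
    · exact hE hE'
    · exact D.asymm' v u h1 h2

/-- A family of subsets is decycling if inverting it yields an acyclic oriented graph. -/
def IsDecycling (D : OrientedGraph V) {k : ℕ} (X : Fin k → Set V) : Prop :=
  (D.invert X).IsAcyclic

/-- The inversion number: the minimum cardinality of a decycling family. -/
noncomputable def inv (D : OrientedGraph V) : ℕ :=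
  sInf {k | ∃ X : Fin k → Set V, D.IsDecycling X}

/-- A tournament: an oriented graph whose underlying graph is complete. -/
def IsTournament (D : OrientedGraph V) : Prop :=
  ∀ u v : V, u ≠ v → D.arc u v ∨ D.arc v u

/-- The subdigraph induced by a set of vertices. -/
def induce (D : OrientedGraph V) (S : Set V) : OrientedGraph S where
  arc a b := D.arc a b
  irrefl' a := D.irrefl' a
  asymm' a b := D.asymm' a b

/-- The dijoin `L ⇒ R`: disjoint union of `L` and `R` plus all arcs from `L` to `R`. -/
def dijoin {α β : Type*} (L : OrientedGraph α) (R : OrientedGraph β) :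
    OrientedGraph (α ⊕ β) where
  arc x y :=
    match x, y with
    | Sum.inl a, Sum.inl b => L.arc a b
    | Sum.inl _, Sum.inr _ => True
    | Sum.inr _, Sum.inl _ => False
    | Sum.inr a, Sum.inr b => R.arc a b
  irrefl' x := by
    cases x with
    | inl a => exact L.irrefl' a
    | inr b => exact R.irrefl' b
  asymm' x y := by
    cases x <;> cases y
    · exact L.asymm' _ _
    · exact fun _ h => h
    · exact fun h _ => h
    · exact R.asymm' _ _

/-- The oriented graph `△(D)`, obtained from `D` by adding two new vertices `u = inr false`
and `v = inr true`, all arcs from `V(D)` to `u`, the arc `u v`, and all arcs from `v`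
to `V(D)`. -/
def triangleExt (D : OrientedGraph V) : OrientedGraph (V ⊕ Bool) where
  arc x y :=
    match x, y with
    | Sum.inl a, Sum.inl b => D.arc a b
    | Sum.inl _, Sum.inr w => w = false
    | Sum.inr w, Sum.inl _ => w = true
    | Sum.inr w, Sum.inr w' => w = false ∧ w' = true
  irrefl' x := by
    cases x with
    | inl a => exact D.irrefl' a
    | inr w => exact fun h => absurd (h.1.symm.trans h.2) (by decide)
  asymm' x y := by
    cases x <;> cases y <;> intro h1 h2
    · exact D.asymm' _ _ h1 h2
    · exact absurd (h1.symm.trans h2) (by decide)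
    · exact absurd (h2.symm.trans h1) (by decide)
    · exact absurd (h1.2.symm.trans h2.1) (by decide)

end OrientedGraph

/-- `maxInv n` is the maximum of the inversion numbers of tournaments of order `n`. -/
noncomputable def maxInv (n : ℕ) : ℕ :=
  sSup {m | ∃ T : OrientedGraph (Fin n), T.IsTournament ∧ T.inv = m}


namespace OrientedGraph

/-- Invert the closed out-neighbourhood of vertex `0`, then delete `0`. -/
def reduce {n : ℕ} (D : OrientedGraph (Fin (n + 1))) : OrientedGraph (Fin n) where
  arc a b := (¬ (D.arc 0 a.succ ∧ D.arc 0 b.succ) ∧ D.arc a.succ b.succ) ∨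
    ((D.arc 0 a.succ ∧ D.arc 0 b.succ) ∧ D.arc b.succ a.succ)
  irrefl' v h := by
    rcases h with ⟨_, h⟩ | ⟨_, h⟩ <;> exact D.irrefl' _ h
  asymm' u v h1 h2 := by
    have := D.asymm' u.succ v.succ
    tauto

lemma reduce_tournament {n : ℕ} {D : OrientedGraph (Fin (n + 1))} (h : D.IsTournament) :
    D.reduce.IsTournament := by
  intro u v huv
  have := h u.succ v.succ (by simpa using huv)
  simp only [reduce]
  tauto

lemma ncard_cons {V : Type*} {k : ℕ} (A : Set V) (X : Fin k → Set V) (u v : V) :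
    Even {i : Fin (k + 1) | u ∈ (Fin.cons A X : Fin (k + 1) → Set V) i ∧
      v ∈ (Fin.cons A X : Fin (k + 1) → Set V) i}.ncard ↔
    ((u ∈ A ∧ v ∈ A) ↔ ¬ Even {i : Fin k | u ∈ X i ∧ v ∈ X i}.ncard) := by
  classical
  rw [Set.ncard_eq_toFinset_card', Set.ncard_eq_toFinset_card', Set.toFinset_ofPred,
    Set.toFinset_ofPred, Fin.card_filter_univ_succ]
  simp only [Fin.cons_zero, Fin.cons_succ]
  split_ifs with h
  · simp [h, Nat.even_add_one]
  · simp [h]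

lemma decycling_step {n k : ℕ} (D : OrientedGraph (Fin (n + 1))) (Y : Fin k → Set (Fin n))
    (h : D.reduce.IsDecycling Y) :
    ∃ X : Fin (k + 1) → Set (Fin (n + 1)), D.IsDecycling X := by
  refine ⟨Fin.cons {v | v = 0 ∨ D.arc 0 v} (fun i => Fin.succ '' Y i), ?_⟩
  set E := D.invert (Fin.cons {v | v = 0 ∨ D.arc 0 v} (fun i => Fin.succ '' Y i) :
    Fin (k + 1) → Set (Fin (n + 1))) with hE
  have h0 : ∀ v, ¬ E.arc 0 v := by
    intro v
    have := D.asymm' 0 v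
    simp only [hE, invert, ncard_cons]
    simp
    have := D.irrefl' 0
    by_cases hv : v = 0
    · subst hv; tauto
    · tauto
  have hs : ∀ a b : Fin n, E.arc a.succ b.succ → (D.reduce.invert Y).arc a b := by
    intro a b
    simp only [hE, invert, ncard_cons, reduce]
    simp [-Nat.not_even_iff_odd]
    tauto
  have key : ∀ u v, Relation.TransGen E.arc u v → ∃ a, u = Fin.succ a ∧
      ∀ b, v = Fin.succ b → Relation.TransGen (D.reduce.invert Y).arc a b := by
    intro u v huv
    induction huv using Relation.TransGen.head_induction_on with
    | @single u hu =>
      rcases Fin.eq_zero_or_eq_succ u with rfl | ⟨a, rfl⟩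
      · exact absurd hu (h0 _)
      · exact ⟨a, rfl, fun b hb => .single (hs _ _ (hb ▸ hu))⟩
    | @head u w hu _ ih =>
      rcases Fin.eq_zero_or_eq_succ u with rfl | ⟨a, rfl⟩
      · exact absurd hu (h0 _)
      · obtain ⟨c, rfl, hc⟩ := ih
        exact ⟨a, rfl, fun b hb => .head (hs _ _ hu) (hc b hb)⟩
  intro v hv
  obtain ⟨a, rfl, ha⟩ := key v v hv
  exact h a (ha a rfl)

lemma exists_decycling (n : ℕ) : ∀ D : OrientedGraph (Fin n),
    ∃ X : Fin n → Set (Fin n), D.IsDecycling X := by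
  induction n with
  | zero => exact fun D => ⟨fun _ => ∅, fun v => v.elim0⟩
  | succ n ih =>
    intro D
    obtain ⟨Y, hY⟩ := ih D.reduce
    exact decycling_step D Y hY

lemma inv_le_order {n : ℕ} (D : OrientedGraph (Fin n)) : D.inv ≤ n :=
  Nat.sInf_le (exists_decycling n D)

lemma inv_le_reduce {n : ℕ} (D : OrientedGraph (Fin (n + 1))) : D.inv ≤ D.reduce.inv + 1 := by
  have hne : {k | ∃ X : Fin k → Set (Fin n), D.reduce.IsDecycling X}.Nonempty :=
    ⟨n, exists_decycling n D.reduce⟩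
  obtain ⟨Y, hY⟩ := Nat.sInf_mem hne
  exact Nat.sInf_le (decycling_step D Y hY)

end OrientedGraph

/-- For every positive integer `n ≥ 2`, `inv(n) ≤ inv(n-1) + 1`. -/
theorem maxInv_le_succ (n : ℕ) (hn : 2 ≤ n) : maxInv n ≤ maxInv (n - 1) + 1 := by
  obtain ⟨m, rfl⟩ : ∃ m, n = m + 1 := ⟨n - 1, by omega⟩
  simp only [Nat.add_sub_cancel]
  refine csSup_le' ?_
  rintro _ ⟨T, hT, rfl⟩
  refine T.inv_le_reduce.trans (Nat.add_le_add_right ?_ 1)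
  refine le_csSup ⟨m, ?_⟩ ⟨T.reduce, OrientedGraph.reduce_tournament hT, rfl⟩
  rintro _ ⟨S, _, rfl⟩
  exact S.inv_le_order
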